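/- If p ≡ 1 (mod 4), then the subgroup Γ_rs of ℚ₊×/N(K×) is cyclic of order 2, and a positive rational g represents its nontrivial element if and only if g is not a local norm from K⊗ℚ₂ over ℚ₂, g is not a local norm from K⊗ℚ_p over ℚ_p, and g is a local norm from K⊗ℚ_ℓ over ℚ_ℓ for every prime ℓ ∉ {2, p}. -/

import Mathlib

/-!
STATEMENT 6.  Let `K = ℚ(√-p)` with `p ≡ 1 (mod 4)`.  Then the subgroup `Γ_rs` of
`ℚ₊ˣ/N(Kˣ)` is cyclic of order 2, and a positive rational `g` represents its
nontrivial element if and only if `g` is not a local norm from `K ⊗ ℚ₂`, not a local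
norm from `K ⊗ ℚ_p`, and is a local norm from `K ⊗ ℚ_ℓ` for every prime `ℓ ∉ {2, p}`.
-/

open scoped TensorProduct

section Grp

variable (K : Type) [Field K] [Algebra ℚ K] [FiniteDimensional ℚ K]

/-- The subgroup `N(Kˣ) ∩ ℚ₊ˣ` of the group `ℚ₊ˣ` of positive rationals. -/
noncomputable def normSubgroup : Subgroup (Units.posSubgroup ℚ) :=
  (Subgroup.comap (Units.posSubgroup ℚ).subtype
    (MonoidHom.range (Units.map (Algebra.norm ℚ : K →* ℚ))))

/-- The group `G = ℚ₊ˣ / N(Kˣ)`. -/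
noncomputable def QmodN := (Units.posSubgroup ℚ) ⧸ normSubgroup K

noncomputable instance : CommGroup (QmodN K) := by
  unfold QmodN; infer_instance

/-- The class of a positive rational number in `ℚ₊ˣ/N(Kˣ)` (junk value `1` if `a ≤ 0`). -/
noncomputable def clsQ (a : ℚ) : QmodN K :=
  if h : 0 < a then QuotientGroup.mk ⟨Units.mk0 a h.ne', h⟩ else 1

/-- O_K -/
noncomputable abbrev OK := integralClosure ℤ K

/-- `ℓ` is inert in `K`: the ideal `ℓ·O_K` is prime. -/
def IsInert (ℓ : ℕ) : Prop := (Ideal.span {(ℓ : OK K)}).IsPrime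

/-- `ℓ` is ramified in `K`: `ℓ·O_K = P²` for a prime ideal `P`. -/
def IsRamified (ℓ : ℕ) : Prop :=
  ∃ P : Ideal (OK K), P.IsPrime ∧ Ideal.span {(ℓ : OK K)} = P ^ 2

/-- `ℓ` is split in `K`: `ℓ·O_K = P·Q` for distinct prime ideals `P ≠ Q`. -/
def IsSplit (ℓ : ℕ) : Prop :=
  ∃ P Q : Ideal (OK K), P.IsPrime ∧ Q.IsPrime ∧ P ≠ Q ∧
    Ideal.span {(ℓ : OK K)} = P * Q

/-- `Γ_in`: the subgroup of `ℚ₊ˣ/N(Kˣ)` generated by the classes of inert primes. -/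
noncomputable def GammaIn : Subgroup (QmodN K) :=
  Subgroup.closure {g | ∃ ℓ : ℕ, ℓ.Prime ∧ IsInert K ℓ ∧ g = clsQ K (ℓ : ℚ)}

/-- `Γ_rs`: the subgroup generated by the classes of split or ramified primes. -/
noncomputable def GammaRs : Subgroup (QmodN K) :=
  Subgroup.closure
    {g | ∃ ℓ : ℕ, ℓ.Prime ∧ (IsSplit K ℓ ∨ IsRamified K ℓ) ∧ g = clsQ K (ℓ : ℚ)}

end Grp

section LocalNorm

variable (K : Type) [Field K] [Algebra ℚ K] (σ : K →ₐ[ℚ] K)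

/-- The canonical involution of `K_ℓ = ℚ_ℓ ⊗ K` induced by the conjugation `σ` of K. -/
noncomputable def sigmaLoc (ℓ : ℕ) [Fact ℓ.Prime] :
    (ℚ_[ℓ] ⊗[ℚ] K) →ₐ[ℚ_[ℓ]] (ℚ_[ℓ] ⊗[ℚ] K) :=
  Algebra.TensorProduct.map (AlgHom.id ℚ_[ℓ] ℚ_[ℓ]) σ

/-- `g` is a local norm at `ℓ`: `g ∈ N(K_ℓˣ)` where `K_ℓ = K ⊗ ℚ_ℓ` and the norm of
`x` is `x · σ(x)`. -/
def IsLocalNorm (ℓ : ℕ) [Fact ℓ.Prime] (g : ℚ) : Prop :=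
  ∃ x : ℚ_[ℓ] ⊗[ℚ] K, IsUnit x ∧
    x * sigmaLoc K σ ℓ x = algebraMap ℚ_[ℓ] (ℚ_[ℓ] ⊗[ℚ] K) (g : ℚ_[ℓ])

end LocalNorm

/-- `c` is represented by the binary quadratic form `x² + d y²`. -/
def IsNormForm {F : Type*} [CommRing F] (d c : F) : Prop := ∃ x y : F, x ^ 2 + d * y ^ 2 = c

/-- The ternary quadratic form `z² - a x² - b y²` has a nontrivial zero. -/
def IsTernaryIsotropic {F : Type*} [CommRing F] (a b : F) : Prop :=
  ∃ x y z : F, (x ≠ 0 ∨ y ≠ 0 ∨ z ≠ 0) ∧ z ^ 2 = a * x ^ 2 + b * y ^ 2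

namespace IsNormForm

variable {F : Type*} [Field F] {d a b : F}

lemma mul (ha : IsNormForm d a) (hb : IsNormForm d b) : IsNormForm d (a * b) := by
  obtain ⟨x, y, rfl⟩ := ha
  obtain ⟨u, v, rfl⟩ := hb
  exact ⟨x * u - d * y * v, x * v + y * u, by ring⟩

lemma of_isSquare (h : IsSquare a) : IsNormForm d a := by
  obtain ⟨c, rfl⟩ := h
  exact ⟨c, 0, by ring⟩

lemma self : IsNormForm d d := ⟨0, 1, by ring⟩

lemma of_mul_left (ha : IsNormForm d a) (h0 : a ≠ 0) (hab : IsNormForm d (a * b)) :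
    IsNormForm d b := by
  have h := (hab.mul ha).mul (of_isSquare (d := d) (a := (a⁻¹) * a⁻¹) ⟨_, rfl⟩)
  convert h using 1
  field_simp

/-- If `-d` is a nonzero square, then `x² + d y²` is a universal form. -/
lemma of_isSquare_neg (h2 : (2 : F) ≠ 0) (hd : d ≠ 0) (h : IsSquare (-d)) :
    IsNormForm d a := by
  obtain ⟨s, hs⟩ := h
  have hs0 : s ≠ 0 := by
    rintro rfl
    simp_all
  refine ⟨(1 + a) / 2, (1 - a) / (2 * s), ?_⟩
  rw [show d = -(s * s) by rw [← hs, neg_neg]]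
  field_simp
  ring

lemma isTernaryIsotropic (h : IsNormForm d a) : IsTernaryIsotropic (-d) a := by
  obtain ⟨x, y, rfl⟩ := h
  exact ⟨y, 1, x, by simp, by ring⟩

end IsNormForm

namespace IsTernaryIsotropic

variable {F : Type*} [Field F] {a b c t d : F}

lemma symm (h : IsTernaryIsotropic a b) : IsTernaryIsotropic b a := by
  obtain ⟨x, y, z, h0, h⟩ := h
  exact ⟨y, x, z, by tauto, by rw [h]; ring⟩

/-- If `b c = t² - a`, the forms `z² - a x² - b y²` and `z² - a x² - c y²` are isotropic together. -/
lemma of_mul_eq_sq_sub (hb : b ≠ 0) (ht : b * c = t ^ 2 - a)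
    (h : IsTernaryIsotropic a b) : IsTernaryIsotropic a c := by
  obtain ⟨x, y, z, h0, h⟩ := h
  by_cases hy : y = 0
  · subst hy
    exact ⟨x, 0, z, h0, by simpa using h⟩
  · refine ⟨z + t * x, b * y, z * t + a * x, Or.inr (Or.inl (mul_ne_zero hb hy)), ?_⟩
    linear_combination (t ^ 2 - a) * h - b * y ^ 2 * ht

lemma of_mul_sq (hd : d ≠ 0) (h : IsTernaryIsotropic a (b * d ^ 2)) : IsTernaryIsotropic a b := by
  obtain ⟨x, y, z, h0, h⟩ := h
  refine ⟨x, d * y, z, by simpa [hd] using h0, by rw [h]; ring⟩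

lemma mul_sq (hd : d ≠ 0) (h : IsTernaryIsotropic a b) : IsTernaryIsotropic a (b * d ^ 2) := by
  obtain ⟨x, y, z, h0, h⟩ := h
  refine ⟨d * x, y, d * z, by simpa [hd] using h0, by linear_combination d ^ 2 * h⟩

end IsTernaryIsotropic

section Padic

variable {q : ℕ} [hq : Fact q.Prime]

lemma PadicInt.toZMod_eq_zero_of_norm_lt_one {x : ℤ_[q]} (h : ‖x‖ < 1) : x.toZMod = 0 := by
  rw [← RingHom.mem_ker, PadicInt.ker_toZMod, IsLocalRing.mem_maximalIdeal]
  exact PadicInt.mem_nonunits.2 h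

lemma Padic.norm_mul_sq_ne_norm_sq {b y w : ℚ_[q]} (hb : b.valuation = 1) (hy : y ≠ 0)
    (hw : w ≠ 0) : ‖b * y ^ 2‖ ≠ ‖w ^ 2‖ := by
  have hb0 : b ≠ 0 := by
    rintro rfl
    simp at hb
  intro h
  rw [Padic.norm_eq_zpow_neg_valuation (by positivity),
    Padic.norm_eq_zpow_neg_valuation (by positivity)] at h
  have h1 := zpow_right_injective₀ (by exact_mod_cast hq.out.pos)
    (by exact_mod_cast hq.out.one_lt.ne') h
  rw [Padic.valuation_mul hb0 (by positivity), Padic.valuation_pow, Padic.valuation_pow, hb] at h1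
  push_cast at h1
  omega

/-- A necessary condition for isotropy at a prime dividing one coefficient exactly once. -/
lemma IsTernaryIsotropic.isSquare_zmod {a b : ℤ} (hb : (b : ℚ_[q]).valuation = 1)
    (h : IsTernaryIsotropic (a : ℚ_[q]) (b : ℚ_[q])) : IsSquare (a : ZMod q) := by
  have hb0 : (b : ℚ_[q]) ≠ 0 := by
    intro h
    simp [h] at hb
  obtain ⟨x, y, z, h0, h⟩ := h
  by_cases hx : x = 0
  · subst hx
    by_cases hy : y = 0
    · subst hy
      simp_all
    · have hz : z ≠ 0 := by
        rintro rfl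
        simp_all
      exact absurd (congrArg norm (by rw [h]; ring)) (Padic.norm_mul_sq_ne_norm_sq hb hy hz)
  · obtain ⟨w, hw⟩ : ∃ w, w = z / x := ⟨_, rfl⟩
    obtain ⟨v, hv⟩ : ∃ v, v = y / x := ⟨_, rfl⟩
    have h1 : w ^ 2 - a = b * v ^ 2 := by
      rw [hw, hv]
      field_simp
      linear_combination h
    have ha : ‖(a : ℚ_[q])‖ ≤ 1 := Padic.norm_int_le_one a
    have hlt : ‖w‖ ≤ 1 ∧ ‖w ^ 2 - a‖ < 1 := by
      by_cases hv0 : v = 0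
      · subst hv0
        have h2 : w ^ 2 = a := by linear_combination h1
        refine ⟨?_, by simp [h2]⟩
        rw [← h2, norm_pow] at ha
        exact (pow_le_one_iff_of_nonneg (norm_nonneg _) two_ne_zero).1 ha
      by_cases hw1 : ‖w‖ ≤ 1
      · refine ⟨hw1, lt_of_le_of_ne ?_ ?_⟩
        · rw [sub_eq_add_neg]
          refine (Padic.nonarchimedean _ _).trans (max_le ?_ (by rwa [norm_neg]))
          rw [norm_pow]
          exact pow_le_one₀ (norm_nonneg _) hw1
        · rw [h1]
          simpa using Padic.norm_mul_sq_ne_norm_sq hb hv0 (one_ne_zero)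
      · exfalso
        push Not at hw1
        have hw0 : w ≠ 0 := by
          rintro rfl
          norm_num at hw1
        refine Padic.norm_mul_sq_ne_norm_sq hb hv0 hw0 ?_
        rw [← h1]
        have h2 : ‖(a : ℚ_[q])‖ < ‖w ^ 2‖ := by
          rw [norm_pow]
          exact ha.trans_lt (one_lt_pow₀ hw1 two_ne_zero)
        refine (Padic.norm_eq_of_norm_sub_lt_left ?_).symm
        simpa using h2
    obtain ⟨W, rfl⟩ : ∃ W : ℤ_[q], (W : ℚ_[q]) = w := ⟨⟨w, hlt.1⟩, rfl⟩
    have h2 := PadicInt.toZMod_eq_zero_of_norm_lt_one (x := W ^ 2 - (a : ℤ_[q]))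
      (by simpa [PadicInt.norm_def] using hlt.2)
    refine ⟨PadicInt.toZMod W, ?_⟩
    rw [map_sub, map_pow, map_intCast, sub_eq_zero] at h2
    rw [← h2, sq]

/-- Hensel's lemma for square roots at an odd prime. -/
lemma PadicInt.isSquare_of_isSquare_toZMod (hq2 : q ≠ 2) {x : ℤ_[q]} (hx : x.toZMod ≠ 0)
    (h : IsSquare x.toZMod) : IsSquare x := by
  obtain ⟨s, hs⟩ := h
  obtain ⟨r, rfl⟩ := ZMod.ringHom_surjective (PadicInt.toZMod (p := q)) s
  have hunit : ∀ y : ℤ_[q], y.toZMod ≠ 0 → ‖y‖ = 1 := fun y hy =>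
    le_antisymm (PadicInt.norm_le_one y)
      (not_lt.1 fun h => hy (PadicInt.toZMod_eq_zero_of_norm_lt_one h))
  have hr : PadicInt.toZMod r ≠ 0 := by
    intro h0
    simp_all
  have h2 : (2 : ℤ_[q]).toZMod ≠ 0 := by
    rw [map_ofNat]
    intro h0
    have : ((2 : ℕ) : ZMod q) = 0 := by exact_mod_cast h0
    rw [ZMod.natCast_eq_zero_iff, Nat.prime_dvd_prime_iff_eq hq.out Nat.prime_two] at this
    exact hq2 this
  have hlt : ‖r ^ 2 - x‖ < 1 := by
    have : (r ^ 2 - x) ∈ RingHom.ker (PadicInt.toZMod (p := q)) := by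
      rw [RingHom.mem_ker, map_sub, map_pow, hs]
      ring
    rw [PadicInt.ker_toZMod, IsLocalRing.mem_maximalIdeal] at this
    exact PadicInt.mem_nonunits.1 this
  obtain ⟨z, hz, -⟩ := hensels_lemma (p := q) (R := ℤ_[q])
    (F := Polynomial.X ^ 2 - Polynomial.C x) (a := r) (by
      simpa [hunit r hr, hunit 2 h2, one_add_one_eq_two] using hlt)
  refine ⟨z, ?_⟩
  simp only [map_sub, map_pow, Polynomial.aeval_X, Polynomial.aeval_C, Algebra.algebraMap_self,
    RingHom.id_apply, sub_eq_zero] at hz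
  rw [← hz, sq]

lemma Padic.isSquare_intCast (hq2 : q ≠ 2) {a : ℤ} (ha : (a : ZMod q) ≠ 0)
    (h : IsSquare (a : ZMod q)) : IsSquare (a : ℚ_[q]) := by
  obtain ⟨z, hz⟩ := PadicInt.isSquare_of_isSquare_toZMod (x := (a : ℤ_[q])) hq2
    (by simpa using ha) (by simpa using h)
  exact ⟨z, by exact_mod_cast congrArg ((↑) : ℤ_[q] → ℚ_[q]) hz⟩

/-- At an odd prime of good reduction, every unit is a value of `x² + d y²`. -/
lemma Padic.isNormForm_of_unit (hq2 : q ≠ 2) {d a : ℤ} (hd : (d : ZMod q) ≠ 0)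
    (ha : (a : ZMod q) ≠ 0) : IsNormForm (d : ℚ_[q]) (a : ℚ_[q]) := by
  have hcard : Fintype.card (ZMod q) % 2 = 1 := by
    rw [ZMod.card]
    exact hq.out.eq_two_or_odd.resolve_left hq2
  obtain ⟨u, v, huv⟩ := FiniteField.exists_root_sum_quadratic (R := ZMod q)
    (f := Polynomial.X ^ 2) (g := Polynomial.C (d : ZMod q) * Polynomial.X ^ 2
      + Polynomial.C 0 * Polynomial.X + Polynomial.C (-(a : ZMod q)))
    (by simp) (Polynomial.degree_quadratic hd) hcard
  simp only [Polynomial.eval_add, Polynomial.eval_mul, Polynomial.eval_pow, Polynomial.eval_X,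
    Polynomial.eval_C] at huv
  obtain ⟨y, rfl⟩ := ZMod.intCast_surjective v
  by_cases hu : u = 0
  · have h0 : ((y : ℤ) : ZMod q) ≠ 0 := by
      intro h0
      simp_all
    obtain ⟨s, hs⟩ := Padic.isSquare_intCast (q := q) (a := a * d) hq2
      (by simpa using ⟨ha, hd⟩) ⟨d * y, by
        push_cast
        linear_combination (-(d : ZMod q)) * huv + d * u * hu⟩
    have hd0 : (d : ℚ_[q]) ≠ 0 := by
      intro h
      rw [Int.cast_eq_zero] at h
      simp [h] at hd
    refine ⟨0, s / d, ?_⟩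
    push_cast at hs
    field_simp
    linear_combination -hs
  · obtain ⟨s, hs⟩ := Padic.isSquare_intCast (q := q) (a := a - d * y ^ 2) hq2
      (by
        push_cast
        intro h0
        refine hu (pow_eq_zero_iff two_ne_zero |>.1 ?_)
        linear_combination huv + h0) ⟨u, by
        push_cast
        linear_combination -huv⟩
    refine ⟨s, y, ?_⟩
    push_cast at hs
    linear_combination -hs

end Padic

lemma Padic.valuation_intCast_eq_one {q : ℕ} [hq : Fact q.Prime] {b : ℤ} (hb : Squarefree b)
    (hqb : (q : ℤ) ∣ b) : (b : ℚ_[q]).valuation = 1 := by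
  obtain ⟨c, rfl⟩ := hqb
  have hc : ¬ (q : ℤ) ∣ c := fun ⟨e, he⟩ =>
    (Nat.prime_iff_prime_int.1 hq.out).not_isUnit (hb q ⟨e, by rw [he]; ring⟩)
  have hc0 : (c : ℚ_[q]) ≠ 0 := by
    rw [Int.cast_ne_zero]
    rintro rfl
    simp at hc
  have hq0 : (q : ℚ_[q]) ≠ 0 := by exact_mod_cast hq.out.ne_zero
  rw [Int.cast_mul, Int.cast_natCast, Padic.valuation_mul hq0 hc0, Padic.valuation_p,
    Padic.valuation_intCast, padicValInt.eq_zero_of_not_dvd hc]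
  rfl

/-- A residue that is a square modulo every prime factor of a squarefree `n` is a square
modulo `n`. -/
lemma exists_dvd_sq_sub_of_squarefree (a : ℤ) (n : ℕ) (hn : Squarefree n)
    (h : ∀ q : ℕ, q.Prime → q ∣ n → IsSquare (a : ZMod q)) : ∃ t : ℤ, (n : ℤ) ∣ t ^ 2 - a := by
  induction n using induction_on_primes with
  | zero => simp at hn
  | one => exact ⟨0, by simp⟩
  | prime_mul q m hq ih =>
    have hcop : Nat.Coprime q m := Nat.coprime_of_squarefree_mul hn
    obtain ⟨t, ht⟩ := ih (hn.squarefree_of_dvd (dvd_mul_left m q))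
      fun r hr hrm => h r hr (hrm.mul_left q)
    obtain ⟨s, hs⟩ := h q hq (dvd_mul_right q m)
    obtain ⟨s, rfl⟩ := ZMod.intCast_surjective s
    have hs' : (q : ℤ) ∣ s ^ 2 - a := by
      rw [← ZMod.intCast_zmod_eq_zero_iff_dvd _ q]
      push_cast
      rw [hs]
      ring
    obtain ⟨u, v, huv⟩ := Nat.isCoprime_iff_coprime.2 hcop
    refine ⟨s * (v * m) + t * (u * q), ?_⟩
    rw [Nat.cast_mul]
    refine (Nat.isCoprime_iff_coprime.2 hcop).mul_dvd ?_ ?_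
    · have : (s * (v * m) + t * (u * q)) ^ 2 - a =
          (s ^ 2 - a) + q * (u * (t - s) * (2 * s + q * (u * (t - s)))) := by
        linear_combination (2 * s * t * u * q + s ^ 2 * (v * m + 1 - u * q)) * huv
      rw [this]
      exact dvd_add hs' (dvd_mul_right _ _)
    · have : (s * (v * m) + t * (u * q)) ^ 2 - a =
          (t ^ 2 - a) + m * (v * (s - t) * (2 * t + m * (v * (s - t)))) := by
        linear_combination (2 * s * t * v * m + t ^ 2 * (u * q + 1 - v * m)) * huv
      rw [this]
      exact dvd_add ht (dvd_mul_right _ _)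

lemma Int.exists_dvd_sub_two_mul_natAbs_le (t : ℤ) {b : ℤ} (hb : b ≠ 0) :
    ∃ s : ℤ, b ∣ t - s ∧ 2 * |s| ≤ |b| := by
  have h1 := Int.emod_nonneg t hb
  have h2 := Int.emod_lt_abs t hb
  have h3 : b ∣ t - t % b := Int.dvd_self_sub_emod
  by_cases h : 2 * (t % b) ≤ |b|
  · exact ⟨t % b, h3, by rwa [abs_of_nonneg h1]⟩
  · refine ⟨t % b - |b|, ?_, ?_⟩
    · rw [show t - (t % b - |b|) = (t - t % b) + |b| by ring]
      exact dvd_add h3 (by simp)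
    · rw [abs_of_neg (by linarith)]
      linarith

/-- **Legendre's theorem**: a ternary form `z² - a x² - b y²` over `ℚ` that is isotropic over `ℝ`
and over `ℚ_q` for all odd primes `q` is isotropic. -/
theorem isTernaryIsotropic_rat_of_forall_padic (a b : ℤ) (ha : a ≠ 0) (hb : b ≠ 0)
    (hpos : 0 < a ∨ 0 < b)
    (h : ∀ (q : ℕ) [Fact q.Prime], q ≠ 2 → IsTernaryIsotropic (a : ℚ_[q]) (b : ℚ_[q])) :
    IsTernaryIsotropic (a : ℚ) (b : ℚ) := by
  induction hn : a.natAbs + b.natAbs using Nat.strong_induction_on generalizing a b with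
  | _ n ih =>
  wlog hab : a.natAbs ≤ b.natAbs generalizing a b
  · exact (this b a hb ha hpos.symm (fun q _ hq => (h q hq).symm) (by omega) (by omega)).symm
  by_cases hsq : Squarefree b
  swap
  · obtain ⟨c, d, hd, rfl⟩ : ∃ c d : ℤ, ¬ IsUnit d ∧ b = c * d ^ 2 := by
      rw [Squarefree] at hsq
      push Not at hsq
      obtain ⟨d, ⟨c, hc⟩, hd⟩ := hsq
      exact ⟨c, d, hd, by rw [hc]; ring⟩
    have hd0 : d ≠ 0 := by
      rintro rfl
      simp at hb
    have hc0 : c ≠ 0 := by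
      rintro rfl
      simp at hb
    have hlt : c.natAbs < (c * d ^ 2).natAbs := by
      rw [Int.natAbs_mul, Int.natAbs_pow]
      have h1 : 1 < d.natAbs := by
        have := mt Int.isUnit_iff_natAbs_eq.2 hd
        omega
      exact lt_mul_of_one_lt_right (by omega) (one_lt_pow₀ h1 two_ne_zero)
    have hpos' : 0 < a ∨ 0 < c :=
      hpos.imp_right fun h => pos_of_mul_pos_left h (sq_nonneg d)
    have := ih _ (by omega) a c ha hc0 hpos' (fun q _ hq => by
      refine IsTernaryIsotropic.of_mul_sq (d := (d : ℚ_[q])) (by exact_mod_cast hd0) ?_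
      exact_mod_cast h q hq) rfl
    exact_mod_cast this.mul_sq (d := (d : ℚ)) (by exact_mod_cast hd0)
  by_cases hb1 : b.natAbs = 1
  · have : a = 1 ∨ b = 1 := by omega
    rcases this with rfl | rfl
    · exact ⟨1, 0, 1, by simp, by simp⟩
    · exact ⟨0, 1, 1, by simp, by simp⟩
  obtain ⟨t, ht⟩ : ∃ t : ℤ, b ∣ t ^ 2 - a := by
    obtain ⟨t, ht⟩ := exists_dvd_sq_sub_of_squarefree a b.natAbs (Int.squarefree_natAbs.2 hsq)
      fun q hq hqb => by
        have : Fact q.Prime := ⟨hq⟩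
        by_cases hq2 : q = 2
        · subst hq2
          generalize (a : ZMod 2) = c
          revert c
          decide
        · exact (h q hq2).isSquare_zmod
            (Padic.valuation_intCast_eq_one hsq (Int.natCast_dvd.2 hqb))
    exact ⟨t, Int.natAbs_dvd.1 ht⟩
  obtain ⟨s, hts, hs⟩ := Int.exists_dvd_sub_two_mul_natAbs_le t hb
  obtain ⟨c, hc⟩ : b ∣ s ^ 2 - a := by
    have : s ^ 2 - a = (t ^ 2 - a) - (t - s) * (t + s) := by ring
    rw [this]
    exact dvd_sub ht (hts.mul_right _)
  by_cases hc0 : c = 0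
  · subst hc0
    refine ⟨1, 0, s, by simp, ?_⟩
    have : s ^ 2 = a := by linarith
    simp [← this]
  have hlt : c.natAbs < b.natAbs := by
    zify
    have h1 : |b| * |c| ≤ |s| ^ 2 + |a| := by
      rw [← abs_mul, ← hc, ← abs_pow]
      exact abs_sub _ _
    have h2 : |a| ≤ |b| := by
      zify at hab
      exact hab
    have h3 : 1 < |b| := by
      have : 1 < b.natAbs := by omega
      zify at this
      exact this
    by_contra! h4
    nlinarith [abs_nonneg s]
  have hpos' : 0 < a ∨ 0 < c := by
    by_contra! h0
    have h1 : 0 < b := hpos.resolve_left h0.1.not_gt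
    nlinarith [sq_nonneg s, lt_of_le_of_ne h0.1 ha]
  have key := ih _ (by omega) a c ha hc0 hpos' (fun q _ hq =>
    (h q hq).of_mul_eq_sq_sub (t := (s : ℚ_[q])) (by exact_mod_cast hb)
      (by exact_mod_cast hc.symm)) rfl
  exact key.of_mul_eq_sq_sub (t := (s : ℚ)) (by exact_mod_cast hc0)
    (by rw [mul_comm]; exact_mod_cast hc.symm)

/-- Hasse norm principle for `x² + d y²`, where the place `2` may be left out. -/
theorem isNormForm_rat_of_forall_padic {d n : ℤ} (hd : 0 < d) (hn : 0 < n)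
    (h : ∀ (q : ℕ) [Fact q.Prime], q ≠ 2 → IsNormForm (d : ℚ_[q]) (n : ℚ_[q])) :
    IsNormForm (d : ℚ) (n : ℚ) := by
  obtain ⟨x, y, z, h0, hxyz⟩ := isTernaryIsotropic_rat_of_forall_padic (-d) n (by omega)
    hn.ne' (Or.inr hn) fun q _ hq => by simpa using (h q hq).isTernaryIsotropic
  have hd' : (0 : ℚ) < d := by exact_mod_cast hd
  push_cast at hxyz
  have hy : y ≠ 0 := by
    rintro rfl
    have hx : x = 0 := by
      by_contra hx
      have : 0 < x ^ 2 := by positivity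
      nlinarith [sq_nonneg z]
    subst hx
    simp_all
  refine ⟨z / y, x / y, ?_⟩
  field_simp
  linear_combination hxyz

lemma not_isNormForm_two_adic {d n : ℤ} (hd : d % 4 = 1) (hn : n % 4 = 3) :
    ¬ IsNormForm (d : ℚ_[2]) (n : ℚ_[2]) := by
  have hd1 : ‖(d : ℚ_[2])‖ = 1 := by
    rw [Padic.norm_intCast_eq_one_iff]
    exact ⟨1, -(d / 2), by push_cast; omega⟩
  have hd' : (d : ZMod (2 ^ 2)) = 1 := by
    exact_mod_cast (ZMod.intCast_eq_intCast_iff' d 1 (2 ^ 2)).2 (by norm_num [hd])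
  have hn' : (n : ZMod (2 ^ 2)) = 3 := by
    exact_mod_cast (ZMod.intCast_eq_intCast_iff' n 3 (2 ^ 2)).2 (by norm_num [hn])
  have aux : ∀ y : ℚ_[2], ‖d * y ^ 2‖ ≤ 1 → ∃ Y : ℤ_[2], (Y : ℚ_[2]) = y := by
    intro y hy
    rw [norm_mul, hd1, one_mul, norm_pow] at hy
    exact ⟨⟨y, (pow_le_one_iff_of_nonneg (norm_nonneg _) two_ne_zero).1 hy⟩, rfl⟩
  rintro ⟨x, y, hxy⟩
  by_cases hx : ‖x‖ ≤ 1
  · obtain ⟨Y, rfl⟩ := aux y (by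
      rw [show d * y ^ 2 = n + -x ^ 2 by linear_combination hxy]
      refine (Padic.nonarchimedean _ _).trans (max_le (Padic.norm_int_le_one n) ?_)
      rw [norm_neg, norm_pow]
      exact pow_le_one₀ (norm_nonneg _) hx)
    obtain ⟨X, rfl⟩ : ∃ X : ℤ_[2], (X : ℚ_[2]) = x := ⟨⟨x, hx⟩, rfl⟩
    have h1 : X ^ 2 + d * Y ^ 2 = n := PadicInt.ext (by push_cast; exact hxy)
    have h2 := congrArg (PadicInt.toZModPow (p := 2) 2) h1
    simp only [map_add, map_mul, map_pow, map_intCast, hd', hn'] at h2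
    generalize PadicInt.toZModPow (p := 2) 2 X = u at h2
    generalize PadicInt.toZModPow (p := 2) 2 Y = v at h2
    revert u v
    decide
  · push Not at hx
    have hx0 : x ≠ 0 := by
      rintro rfl
      norm_num at hx
    obtain ⟨W, hW⟩ : ∃ W : ℤ_[2], (W : ℚ_[2]) = x⁻¹ :=
      ⟨⟨x⁻¹, by rw [norm_inv]; exact inv_le_one_of_one_le₀ hx.le⟩, rfl⟩
    have h0 : d * (y / x) ^ 2 = n * (W : ℚ_[2]) ^ 2 + -1 := by
      rw [hW]
      field_simp
      linear_combination hxy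
    obtain ⟨Y, hY⟩ := aux (y / x) (by
      rw [h0]
      refine (Padic.nonarchimedean _ _).trans (max_le ?_ (by simp))
      have := PadicInt.norm_le_one ((n : ℤ_[2]) * W ^ 2)
      rw [PadicInt.norm_def] at this
      push_cast at this
      exact this)
    rw [← hY] at h0
    have h1 : d * Y ^ 2 = n * W ^ 2 + -1 := PadicInt.ext (by push_cast; exact h0)
    have h2 := congrArg (PadicInt.toZModPow (p := 2) 2) h1
    simp only [map_add, map_mul, map_pow, map_intCast, hd', hn', map_neg, map_one] at h2
    generalize PadicInt.toZModPow (p := 2) 2 W = u at h2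
    generalize PadicInt.toZModPow (p := 2) 2 Y = v at h2
    revert u v
    decide

lemma ZMod.isSquare_mul_of_not_isSquare {p : ℕ} [Fact p.Prime] {a b : ZMod p}
    (ha : ¬ IsSquare a) (hb : ¬ IsSquare b) : IsSquare (a * b) := by
  have h0 : a * b ≠ 0 := mul_ne_zero (fun h => ha (by simp [h])) fun h => hb (by simp [h])
  rw [← quadraticChar_one_iff_isSquare h0, map_mul,
    quadraticChar_neg_one_iff_not_isSquare.2 ha, quadraticChar_neg_one_iff_not_isSquare.2 hb]
  rfl

lemma exists_prime_mod_four_eq_three_isSquare_neg {p : ℕ} [hp : Fact p.Prime] (hp1 : p % 4 = 1) :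
    ∃ l : ℕ, l.Prime ∧ l % 4 = 3 ∧ IsSquare (-(p : ZMod l)) := by
  obtain ⟨c, hc⟩ := FiniteField.exists_nonsquare (F := ZMod p) (by
    rw [ZMod.ringChar_zmod_n]
    rintro rfl
    simp at hp1)
  have hc0 : c ≠ 0 := by
    rintro rfl
    simp at hc
  have hcop : Nat.Coprime 4 p := by
    rw [show 4 = 2 ^ 2 by norm_num]
    refine Nat.Coprime.pow_left 2 ((Nat.coprime_primes Nat.prime_two hp.out).2 ?_)
    rintro rfl
    simp at hp1
  have : NeZero (4 * p) := ⟨mul_ne_zero (by norm_num) hp.out.ne_zero⟩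
  obtain ⟨l, -, hl, hle⟩ := Nat.forall_exists_prime_gt_and_eq_mod (q := 4 * p)
    (a := (ZMod.chineseRemainder hcop).symm (3, c))
    ((Prod.isUnit_iff.2 ⟨(by decide : IsUnit (3 : ZMod 4)), hc0.isUnit⟩).map
      (ZMod.chineseRemainder hcop).symm) 0
  have hle' : ((l : ZMod 4), (l : ZMod p)) = (3, c) := by
    have := congrArg (ZMod.chineseRemainder hcop) hle
    rw [RingEquiv.apply_symm_apply, map_natCast] at this
    exact this
  have hl4 : l % 4 = 3 := by
    have := (ZMod.natCast_eq_natCast_iff' l 3 4).1 (congrArg Prod.fst hle')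
    simpa using this
  have hlp : (l : ZMod p) = c := congrArg Prod.snd hle'
  have : Fact l.Prime := ⟨hl⟩
  refine ⟨l, hl, hl4, ?_⟩
  have h1 : ¬ IsSquare (p : ZMod l) := by
    rw [← ZMod.exists_sq_eq_prime_iff_of_mod_four_eq_one hp1 (by omega), hlp]
    exact hc
  have h2 : ¬ IsSquare (-1 : ZMod l) := by
    rw [ZMod.exists_sq_eq_neg_one_iff]
    omega
  have h3 := ZMod.isSquare_mul_of_not_isSquare h1 h2
  simpa using h3

section ClassGroup

variable {K : Type} [Field K] [Algebra ℚ K]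

lemma clsQ_of_pos {a : ℚ} (ha : 0 < a) (ha' : Units.mk0 a ha.ne' ∈ Units.posSubgroup ℚ) :
    clsQ K a = QuotientGroup.mk (s := normSubgroup K) ⟨Units.mk0 a ha.ne', ha'⟩ :=
  dif_pos ha

lemma clsQ_mul {a b : ℚ} (ha : 0 < a) (hb : 0 < b) : clsQ K (a * b) = clsQ K a * clsQ K b := by
  have ha' : Units.mk0 a ha.ne' ∈ Units.posSubgroup ℚ := ha
  have hb' : Units.mk0 b hb.ne' ∈ Units.posSubgroup ℚ := hb
  rw [clsQ_of_pos ha ha', clsQ_of_pos hb hb', clsQ_of_pos (mul_pos ha hb)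
    (Units.mk0_mul a b (mul_pos ha hb).ne' ▸ mul_mem ha' hb')]
  exact congrArg (QuotientGroup.mk (s := normSubgroup K)) (Subtype.ext (Units.ext rfl))

lemma exists_clsQ_eq (h : QmodN K) : ∃ g : ℚ, 0 < g ∧ clsQ K g = h := by
  obtain ⟨⟨u, hu⟩, rfl⟩ := QuotientGroup.mk_surjective h
  have hu' : 0 < (u : ℚ) := hu
  refine ⟨u, hu', ?_⟩
  have hu'' : Units.mk0 (u : ℚ) hu'.ne' ∈ Units.posSubgroup ℚ := hu
  rw [clsQ_of_pos hu' hu'']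
  exact congrArg (QuotientGroup.mk (s := normSubgroup K)) (Subtype.ext (Units.ext rfl))

lemma clsQ_eq_one_iff_exists_norm [FiniteDimensional ℚ K] {a : ℚ} (ha : 0 < a) :
    clsQ K a = 1 ↔ ∃ x : K, Algebra.norm ℚ x = a := by
  have ha' : Units.mk0 a ha.ne' ∈ Units.posSubgroup ℚ := ha
  rw [clsQ_of_pos ha ha']
  refine (QuotientGroup.eq_one_iff (N := normSubgroup K) _).trans ?_
  constructor
  · rintro ⟨u, hu⟩
    exact ⟨u, by simpa using congrArg Units.val hu⟩
  · rintro ⟨x, hx⟩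
    have hx0 : x ≠ 0 := by
      rintro rfl
      rw [Algebra.norm_zero] at hx
      exact ha.ne hx
    exact ⟨Units.mk0 x hx0, Units.ext hx⟩

end ClassGroup

lemma isIntegral_sqrt_neg {p : ℕ} {K : Type} [Field K] {sp : K} (hsp : sp ^ 2 = -(p : K)) :
    IsIntegral ℤ sp :=
  IsIntegral.of_pow two_pos (by
    rw [hsp]
    simpa using isIntegral_algebraMap (R := ℤ) (A := K) (x := -(p : ℤ)))

lemma exists_intCast_eq_of_isIntegral {K : Type} [Field K] [Algebra ℚ K] {r : ℚ}
    (h : IsIntegral ℤ (algebraMap ℚ K r)) :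
    ∃ n : ℤ, (n : ℚ) = r :=
  IsIntegrallyClosed.isIntegral_iff.1
    ((isIntegral_algebraMap_iff (algebraMap ℚ K).injective).1 h)

lemma one_add_sqrt_neg_notMem_span {p : ℕ} (hp1 : p % 4 = 1) {K : Type} [Field K]
    [Algebra ℚ K] {sp : K} (hsp : sp ^ 2 = -(p : K)) {σ : K →ₐ[ℚ] K} (hσ : σ sp = -sp) {s : OK K}
    (hs : (s : K) = sp) : 1 + s ∉ Ideal.span {((2 : ℕ) : OK K)} := by
  rw [Ideal.mem_span_singleton]
  rintro ⟨a, ha⟩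
  have h1 : 1 + sp = 2 * (a : K) := by
    rw [Nat.cast_ofNat] at ha
    have h := congrArg (algebraMap (OK K) K) ha
    rwa [map_add, map_mul, map_one, map_ofNat, show algebraMap (OK K) K s = sp from hs] at h
  have h2 : 1 - sp = 2 * σ a := by
    simpa [hσ, sub_eq_add_neg, map_ofNat] using congrArg σ h1
  have ha : IsIntegral ℤ (a : K) := a.2
  have hσa : IsIntegral ℤ (σ a) := ha.map (σ.restrictScalars ℤ)
  have : CharZero K := algebraRat.charZero K
  obtain ⟨n, hn⟩ := exists_intCast_eq_of_isIntegral (K := K) (r := (1 + p) / 4) (by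
    have hβ : algebraMap ℚ K ((1 + p) / 4) = a * σ a := by
      rw [map_div₀, div_eq_iff (by simp)]
      simp only [map_add, map_one, map_ofNat, map_natCast]
      linear_combination hsp + (1 - sp) * h1 + 2 * a * h2
    rw [hβ]
    exact ha.mul hσa)
  have h3 : ((n * 4 : ℤ) : ℚ) = ((1 + p : ℤ) : ℚ) := by
    push_cast
    rw [hn]
    field_simp
  have := Int.cast_injective h3
  omega

section Quadratic

variable {p : ℕ} [hp : Fact p.Prime] {K : Type} [Field K] [Algebra ℚ K] {sp : K}

lemma linearIndependent_one_sqrt_neg (hsp : sp ^ 2 = -(p : K)) :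
    LinearIndependent ℚ ![(1 : K), sp] := by
  have hp0 : (0 : ℚ) < p := by exact_mod_cast hp.out.pos
  rw [LinearIndependent.pair_iff]
  intro s t h
  have h1 : t ^ 2 * -p = s ^ 2 := by
    apply (algebraMap ℚ K).injective
    rw [Algebra.smul_def, Algebra.smul_def, mul_one] at h
    rw [map_mul, map_pow, map_pow, map_neg, map_natCast, ← hsp]
    linear_combination (algebraMap ℚ K t * sp - algebraMap ℚ K s) * h
  have ht : t = 0 := by
    by_contra ht
    have : 0 < t ^ 2 := by positivity
    nlinarith [sq_nonneg s]
  subst ht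
  refine ⟨?_, rfl⟩
  simpa using h1.symm

noncomputable def sqrtNegBasis (hK2 : Module.finrank ℚ K = 2) (hsp : sp ^ 2 = -(p : K)) :
    Module.Basis (Fin 2) ℚ K :=
  basisOfLinearIndependentOfCardEqFinrank (linearIndependent_one_sqrt_neg hsp) (by simp [hK2])

lemma sqrtNegBasis_apply (hK2 : Module.finrank ℚ K = 2) (hsp : sp ^ 2 = -(p : K)) (i : Fin 2) :
    sqrtNegBasis hK2 hsp i = ![(1 : K), sp] i := by
  simp [sqrtNegBasis]

lemma exists_eq_add_mul_sqrt_neg (hK2 : Module.finrank ℚ K = 2) (hsp : sp ^ 2 = -(p : K))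
    (k : K) : ∃ x y : ℚ, k = algebraMap ℚ K x + algebraMap ℚ K y * sp := by
  refine ⟨(sqrtNegBasis hK2 hsp).repr k 0, (sqrtNegBasis hK2 hsp).repr k 1, ?_⟩
  conv_lhs => rw [← (sqrtNegBasis hK2 hsp).sum_repr k]
  simp [sqrtNegBasis_apply, Algebra.smul_def]

lemma norm_add_mul_sqrt_neg (hK2 : Module.finrank ℚ K = 2) (hsp : sp ^ 2 = -(p : K)) (x y : ℚ) :
    Algebra.norm ℚ (algebraMap ℚ K x + algebraMap ℚ K y * sp) = x ^ 2 + p * y ^ 2 := by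
  have h1 : (algebraMap ℚ K x + algebraMap ℚ K y * sp) * sqrtNegBasis hK2 hsp 0 =
      x • sqrtNegBasis hK2 hsp 0 + y • sqrtNegBasis hK2 hsp 1 := by
    simp [sqrtNegBasis_apply, Algebra.smul_def]
  have h2 : (algebraMap ℚ K x + algebraMap ℚ K y * sp) * sqrtNegBasis hK2 hsp 1 =
      (-(p * y)) • sqrtNegBasis hK2 hsp 0 + x • sqrtNegBasis hK2 hsp 1 := by
    simp [sqrtNegBasis_apply, Algebra.smul_def]
    have : CharZero K := algebraRat.charZero K
    push_cast
    linear_combination (y : K) * hsp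
  rw [Algebra.norm_eq_matrix_det (sqrtNegBasis hK2 hsp), Matrix.det_fin_two]
  simp only [Algebra.leftMulMatrix_eq_repr_mul, h1, h2, map_add, map_smul, Module.Basis.repr_self,
    Finsupp.add_apply, Finsupp.smul_apply, Finsupp.single_apply, smul_eq_mul]
  norm_num
  ring

lemma clsQ_eq_one_iff [FiniteDimensional ℚ K] (hK2 : Module.finrank ℚ K = 2)
    (hsp : sp ^ 2 = -(p : K)) {a : ℚ} (ha : 0 < a) : clsQ K a = 1 ↔ IsNormForm (p : ℚ) a := by
  rw [clsQ_eq_one_iff_exists_norm ha]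
  constructor
  · rintro ⟨k, hk⟩
    obtain ⟨x, y, rfl⟩ := exists_eq_add_mul_sqrt_neg hK2 hsp k
    exact ⟨x, y, by rw [← hk, norm_add_mul_sqrt_neg hK2 hsp]⟩
  · rintro ⟨x, y, h⟩
    exact ⟨_, (norm_add_mul_sqrt_neg hK2 hsp x y).trans h⟩

lemma isLocalNorm_iff (hK2 : Module.finrank ℚ K = 2) (hsp : sp ^ 2 = -(p : K)) {σ : K →ₐ[ℚ] K}
    (hσ : σ sp = -sp) (l : ℕ) [Fact l.Prime] {g : ℚ} (hg : g ≠ 0) :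
    IsLocalNorm K σ l g ↔ IsNormForm (p : ℚ_[l]) (g : ℚ_[l]) := by
  have hnorm : ∀ a b : ℚ_[l], (a ⊗ₜ[ℚ] (1 : K) + b ⊗ₜ[ℚ] sp) *
      sigmaLoc K σ l (a ⊗ₜ[ℚ] (1 : K) + b ⊗ₜ[ℚ] sp) =
      algebraMap ℚ_[l] (ℚ_[l] ⊗[ℚ] K) (a ^ 2 + p * b ^ 2) := by
    intro a b
    have hpp : (b * b) ⊗ₜ[ℚ] (sp * sp) = -((p * b ^ 2) ⊗ₜ[ℚ] (1 : K)) := by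
      rw [← sq sp, hsp, TensorProduct.tmul_neg,
        show (p : K) = (p : ℚ) • (1 : K) by simp [Algebra.smul_def],
        ← TensorProduct.smul_tmul, Algebra.smul_def, map_natCast, sq]
    simp only [sigmaLoc, map_add, Algebra.TensorProduct.map_tmul, AlgHom.id_apply, map_one, hσ,
      add_mul, mul_add, Algebra.TensorProduct.tmul_mul_tmul, TensorProduct.tmul_neg, mul_neg,
      hpp, one_mul, mul_one, Algebra.TensorProduct.algebraMap_apply, Algebra.algebraMap_self,
      RingHom.id_apply, mul_comm b a, sq a]
    abel
  constructor
  · rintro ⟨x, -, hx⟩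
    obtain ⟨a, b, rfl⟩ : ∃ a b : ℚ_[l], x = a ⊗ₜ[ℚ] (1 : K) + b ⊗ₜ[ℚ] sp := by
      clear hx
      induction x using TensorProduct.induction_on with
      | zero => exact ⟨0, 0, by simp⟩
      | tmul c k =>
        obtain ⟨x, y, rfl⟩ := exists_eq_add_mul_sqrt_neg hK2 hsp k
        refine ⟨x • c, y • c, ?_⟩
        rw [TensorProduct.tmul_add, ← Algebra.smul_def, Algebra.algebraMap_eq_smul_one,
          TensorProduct.smul_tmul, TensorProduct.smul_tmul]
      | add x y hx hy =>
        obtain ⟨a, b, rfl⟩ := hx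
        obtain ⟨c, d, rfl⟩ := hy
        exact ⟨a + c, b + d, by simp only [TensorProduct.add_tmul]; abel⟩
    rw [hnorm] at hx
    exact ⟨a, b, (algebraMap ℚ_[l] (ℚ_[l] ⊗[ℚ] K)).injective hx⟩
  · rintro ⟨a, b, hab⟩
    have h := hnorm a b
    rw [hab] at h
    refine ⟨_, ?_, h⟩
    refine isUnit_of_mul_isUnit_left (y := sigmaLoc K σ l (a ⊗ₜ[ℚ] (1 : K) + b ⊗ₜ[ℚ] sp)) ?_
    rw [h]
    exact (IsUnit.mk0 _ (by exact_mod_cast hg)).map _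

lemma sqrt_neg_add_intCast_notMem_span (hsp : sp ^ 2 = -(p : K)) {σ : K →ₐ[ℚ] K}
    (hσ : σ sp = -sp) {q : ℕ} (hq : q.Prime) (hq2 : q ≠ 2) (t : ℤ) {s : OK K} (hs : (s : K) = sp) :
    s + (t : OK K) ∉ Ideal.span {(q : OK K)} := by
  have : CharZero K := algebraRat.charZero K
  rw [Ideal.mem_span_singleton]
  rintro ⟨a, ha⟩
  have h1 : sp + t = q * (a : K) := by
    rw [← hs]
    exact_mod_cast congrArg ((↑) : OK K → K) ha
  have h2 : -sp + t = q * σ a := by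
    simpa [hσ] using congrArg σ h1
  have ha : IsIntegral ℤ (a : K) := a.2
  have hσa : IsIntegral ℤ (σ a) := ha.map (σ.restrictScalars ℤ)
  have hq0 : (q : K) ≠ 0 := by exact_mod_cast hq.ne_zero
  obtain ⟨n, hn⟩ := exists_intCast_eq_of_isIntegral (K := K) (r := -(4 * p) / q ^ 2) (by
    have hβ : algebraMap ℚ K (-(4 * p) / q ^ 2) = (a - σ a) ^ 2 := by
      rw [map_div₀, div_eq_iff (by simpa using hq0)]
      simp only [map_neg, map_mul, map_ofNat, map_natCast, map_pow]
      linear_combination -4 * hsp + (2 * sp + q * (a - σ a)) * (h1 - h2)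
    rw [hβ]
    exact (ha.sub hσa).pow 2)
  have hq0' : (q : ℚ) ≠ 0 := by exact_mod_cast hq.ne_zero
  have h3 : ((q ^ 2 * n : ℤ) : ℚ) = ((-(4 * p) : ℤ) : ℚ) := by
    push_cast
    rw [hn]
    field_simp
  have h4 : (q : ℤ) ^ 2 ∣ 4 * p := ⟨-n, by linarith [Int.cast_injective h3]⟩
  have h5 : q ^ 2 ∣ 4 * p := by exact_mod_cast h4
  have h6 : Nat.Coprime (q ^ 2) 4 := by
    rw [show 4 = 2 ^ 2 by norm_num]
    exact Nat.Coprime.pow 2 2 ((Nat.coprime_primes hq Nat.prime_two).2 hq2)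
  have h7 := h6.dvd_of_dvd_mul_left h5
  exact hq.not_isUnit (hp.out.prime.squarefree q (by rwa [← sq]))

lemma not_isPrime_span_natCast (hp1 : p % 4 = 1) (hsp : sp ^ 2 = -(p : K)) {σ : K →ₐ[ℚ] K}
    (hσ : σ sp = -sp) {q : ℕ} (hq : q.Prime) (h : IsSquare (-(p : ZMod q))) :
    ¬ (Ideal.span {(q : OK K)}).IsPrime := by
  intro hP
  obtain ⟨s, hs⟩ : ∃ s : OK K, (s : K) = sp := ⟨⟨sp, isIntegral_sqrt_neg hsp⟩, rfl⟩
  have hs2 : s ^ 2 = -(p : OK K) := Subtype.ext (by push_cast; rw [hs, hsp])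
  by_cases hq2 : q = 2
  · subst hq2
    refine one_add_sqrt_neg_notMem_span hp1 hsp hσ hs (hP.mem_of_pow_mem 2 ?_)
    obtain ⟨k, hk⟩ : ∃ k, p = 2 * k + 1 := ⟨p / 2, by omega⟩
    rw [Ideal.mem_span_singleton]
    refine ⟨s - k, ?_⟩
    rw [hk] at hs2
    push_cast at hs2 ⊢
    linear_combination hs2
  · obtain ⟨t, ht⟩ := h
    obtain ⟨t, rfl⟩ := ZMod.intCast_surjective t
    obtain ⟨c, hc⟩ : (q : ℤ) ∣ t ^ 2 + p := by
      rw [← ZMod.intCast_zmod_eq_zero_iff_dvd _ q]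
      push_cast
      linear_combination -ht
    have hc' : (t : OK K) ^ 2 + p = q * c := by exact_mod_cast congrArg (Int.cast : ℤ → OK K) hc
    have hmem : (s + (t : OK K)) * (s + ((-t : ℤ) : OK K)) ∈ Ideal.span {(q : OK K)} := by
      rw [Ideal.mem_span_singleton]
      refine ⟨-c, ?_⟩
      push_cast
      linear_combination hs2 - hc'
    exact (hP.mem_or_mem hmem).elim (sqrt_neg_add_intCast_notMem_span hsp hσ hq hq2 t hs)
      (sqrt_neg_add_intCast_notMem_span hsp hσ hq hq2 (-t) hs)

/-- A prime is split or ramified in `ℚ(√-p)` iff `-p` is a square modulo it. -/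
lemma isSplit_or_isRamified_iff [FiniteDimensional ℚ K] (hp1 : p % 4 = 1)
    (hK2 : Module.finrank ℚ K = 2) (hsp : sp ^ 2 = -(p : K)) {σ : K →ₐ[ℚ] K} (hσ : σ sp = -sp)
    {q : ℕ} (hq : q.Prime) : IsSplit K q ∨ IsRamified K q ↔ IsSquare (-(p : ZMod q)) := by
  have : CharZero K := algebraRat.charZero K
  have : IsDedekindDomain (OK K) := integralClosure.isDedekindDomain ℤ ℚ K
  have : Module.Finite ℤ (OK K) := IsIntegralClosure.finite ℤ ℚ K (OK K)
  have : Module.Free ℤ (OK K) := IsIntegralClosure.module_free ℤ ℚ K (OK K)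
  have hnorm : Ideal.absNorm (Ideal.span {(q : OK K)}) = q ^ 2 := by
    rw [Ideal.absNorm_span_natCast, IsIntegralClosure.rank ℤ ℚ K (OK K), hK2]
  constructor
  · intro h
    obtain ⟨P, Q, hP, hQ, hPQ⟩ : ∃ P Q : Ideal (OK K), P.IsPrime ∧ Q.IsPrime ∧
        Ideal.span {(q : OK K)} = P * Q := by
      rcases h with ⟨P, Q, hP, hQ, -, h⟩ | ⟨P, hP, h⟩
      · exact ⟨P, Q, hP, hQ, h⟩
      · exact ⟨P, P, hP, hP, by rw [h, sq]⟩
    rw [hPQ, map_mul] at hnorm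
    have hPn := ((hq.mul_eq_prime_sq_iff (mt Ideal.absNorm_eq_one_iff.1 hP.ne_top)
      (mt Ideal.absNorm_eq_one_iff.1 hQ.ne_top)).1 hnorm).1
    have hcard : Nat.card (OK K ⧸ P) = q := hPn
    have : Finite (OK K ⧸ P) := Nat.finite_of_card_ne_zero (by rw [hcard]; exact hq.ne_zero)
    have := Fintype.ofFinite (OK K ⧸ P)
    let e := ZMod.ringEquivOfPrime (OK K ⧸ P) hq (by rw [← Nat.card_eq_fintype_card, hcard])
    obtain ⟨s, hs⟩ : ∃ s : OK K, (s : K) = sp := ⟨⟨sp, isIntegral_sqrt_neg hsp⟩, rfl⟩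
    have hs2 : s ^ 2 = -(p : OK K) := Subtype.ext (by push_cast; rw [hs, hsp])
    refine ⟨e.symm (Ideal.Quotient.mk P s), ?_⟩
    rw [← map_mul, ← map_mul, ← sq, hs2, map_neg, map_natCast]
    exact (((e.symm : (OK K ⧸ P) →+* ZMod q).map_neg _).trans
      (congrArg Neg.neg (map_natCast (e.symm : (OK K ⧸ P) →+* ZMod q) p))).symm
  · intro h
    have hI : Ideal.span {(q : OK K)} ≠ ⊤ := by
      rw [Ne, ← Ideal.absNorm_eq_one_iff, hnorm]
      exact (one_lt_pow₀ hq.one_lt two_ne_zero).ne'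
    obtain ⟨P, hPm, hP⟩ := Ideal.exists_le_maximal _ hI
    obtain ⟨Q, hPQ⟩ := Ideal.dvd_iff_le.2 hP
    have hQ : Q ≠ ⊤ := by
      rintro rfl
      refine not_isPrime_span_natCast hp1 hsp hσ hq h ?_
      rw [hPQ, Ideal.mul_top]
      exact hPm.isPrime
    have hnorm' := hnorm
    rw [hPQ, map_mul] at hnorm'
    have hQn := ((hq.mul_eq_prime_sq_iff (mt Ideal.absNorm_eq_one_iff.1 hPm.ne_top)
      (mt Ideal.absNorm_eq_one_iff.1 hQ)).1 hnorm').2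
    have hQp : Q.IsPrime := Ideal.isPrime_of_irreducible_absNorm (by rw [hQn]; exact hq)
    by_cases hne : P = Q
    · exact Or.inr ⟨P, hPm.isPrime, by rw [hPQ, ← hne, sq]⟩
    · exact Or.inl ⟨P, Q, hPm.isPrime, hQp, hne, hPQ⟩

lemma exists_squarefree_eq_mul_sq {g : ℚ} (hg : 0 < g) :
    ∃ n : ℕ, Squarefree n ∧ ∃ c : ℚ, c ≠ 0 ∧ g = n * c ^ 2 := by
  have hnum : 0 < g.num := Rat.num_pos.2 hg
  obtain ⟨a, b, -, hb, hab, ha⟩ :=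
    Nat.sq_mul_squarefree_of_pos (n := g.num.natAbs * g.den) (by positivity)
  have hb0 : (b : ℚ) ≠ 0 := by exact_mod_cast hb.ne'
  have hd0 : (g.den : ℚ) ≠ 0 := by exact_mod_cast g.den_ne_zero
  refine ⟨a, ha, b / g.den, div_ne_zero hb0 hd0, ?_⟩
  have h1 : (b : ℚ) ^ 2 * a = g.num * g.den := by
    have h : ((b ^ 2 * a : ℕ) : ℤ) = g.num * g.den := by
      rw [hab]
      push_cast
      rw [abs_of_pos hnum]
    exact_mod_cast h
  have h2 := Rat.mul_den_eq_num g
  field_simp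
  linear_combination g.den * h2 - h1

lemma IsNormForm.mul_sq_iff {F : Type*} [Field F] {d a c : F} (hc : c ≠ 0) :
    IsNormForm d (a * c ^ 2) ↔ IsNormForm d a := by
  have h : IsNormForm d (c ^ 2) := .of_isSquare ⟨c, sq c⟩
  exact ⟨fun h' => h.of_mul_left (pow_ne_zero 2 hc) (by rwa [mul_comm]), fun h' => h'.mul h⟩

lemma IsNormForm.ratCast {F : Type*} [Field F] [CharZero F] {d : ℕ} {g : ℚ}
    (h : IsNormForm (d : ℚ) g) : IsNormForm (d : F) (g : F) := by
  obtain ⟨x, y, rfl⟩ := h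
  exact ⟨x, y, by push_cast; rfl⟩

lemma exists_isNormForm_self_eq_mul {g : ℚ} (hg : 0 < g) :
    ∃ m : ℕ, (m : ZMod p) ≠ 0 ∧ ∃ c : ℚ, IsNormForm (p : ℚ) c ∧ g = m * c := by
  obtain ⟨n, hn, c, -, rfl⟩ := exists_squarefree_eq_mul_sq hg
  have hc : IsNormForm (p : ℚ) (c ^ 2) := .of_isSquare ⟨c, sq c⟩
  by_cases hpn : p ∣ n
  · obtain ⟨m, rfl⟩ := hpn
    refine ⟨m, fun h => ?_, p * c ^ 2, IsNormForm.self.mul hc, by push_cast; ring⟩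
    rw [ZMod.natCast_eq_zero_iff] at h
    exact hp.out.not_isUnit (hn p (mul_dvd_mul_left p h))
  · exact ⟨n, by rwa [Ne, ZMod.natCast_eq_zero_iff], c ^ 2, hc, rfl⟩

lemma Padic.isNormForm_self_mul_of_not (hp2 : p ≠ 2) {g h : ℚ} (hg : 0 < g) (hh : 0 < h)
    (hg' : ¬ IsNormForm (p : ℚ_[p]) (g : ℚ_[p])) (hh' : ¬ IsNormForm (p : ℚ_[p]) (h : ℚ_[p])) :
    IsNormForm (p : ℚ_[p]) ((g * h : ℚ) : ℚ_[p]) := by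
  have key : ∀ m : ℕ, (m : ZMod p) ≠ 0 → IsSquare (m : ZMod p) →
      IsNormForm (p : ℚ_[p]) (m : ℚ_[p]) := fun m h0 hs => by
    have := Padic.isSquare_intCast hp2 (a := m) (by exact_mod_cast h0) (by exact_mod_cast hs)
    exact .of_isSquare (by exact_mod_cast this)
  obtain ⟨m, hm, c, hc, rfl⟩ := exists_isNormForm_self_eq_mul (p := p) hg
  obtain ⟨n, hn, e, he, rfl⟩ := exists_isNormForm_self_eq_mul (p := p) hh
  have hms : ¬ IsSquare (m : ZMod p) := fun hs => hg' (by
    push_cast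
    exact (key m hm hs).mul hc.ratCast)
  have hns : ¬ IsSquare (n : ZMod p) := fun hs => hh' (by
    push_cast
    exact (key n hn hs).mul he.ratCast)
  have hmn := key (m * n) (by push_cast; exact mul_ne_zero hm hn)
    (by push_cast; exact ZMod.isSquare_mul_of_not_isSquare hms hns)
  have := hmn.mul (hc.mul he).ratCast
  push_cast at this ⊢
  rwa [mul_mul_mul_comm]

lemma Padic.isNormForm_of_isSquare_neg_zmod {l : ℕ} [hl : Fact l.Prime] (hl2 : l ≠ 2) (hlp : l ≠ p)
    (h : IsSquare (-(p : ZMod l))) (a : ℚ_[l]) : IsNormForm (p : ℚ_[l]) a := by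
  have hpl : (p : ZMod l) ≠ 0 := by
    rw [Ne, ZMod.natCast_eq_zero_iff, Nat.prime_dvd_prime_iff_eq hl.out hp.out]
    exact hlp
  have := Padic.isSquare_intCast hl2 (a := -p) (by simpa using hpl) (by simpa using h)
  exact .of_isSquare_neg two_ne_zero (by exact_mod_cast hp.out.ne_zero) (by simpa using this)

/-- Hasse's norm theorem for `ℚ(√-p)` and positive rationals; the place `2` can be omitted by
reciprocity. -/
lemma isNormForm_of_forall_padic {g : ℚ} (hg : 0 < g)
    (h : ∀ (l : ℕ) [Fact l.Prime], l ≠ 2 → IsNormForm (p : ℚ_[l]) (g : ℚ_[l])) :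
    IsNormForm (p : ℚ) g := by
  obtain ⟨n, hn, c, hc, rfl⟩ := exists_squarefree_eq_mul_sq hg
  rw [IsNormForm.mul_sq_iff hc]
  have hn0 : 0 < n := Nat.pos_of_ne_zero hn.ne_zero
  have := isNormForm_rat_of_forall_padic (d := p) (n := n) (by exact_mod_cast hp.out.pos)
    (by exact_mod_cast hn0) fun q _ hq => by
      have := h q hq
      push_cast at this ⊢
      rwa [IsNormForm.mul_sq_iff (by exact_mod_cast hc)] at this
  exact_mod_cast this

lemma clsQ_mul_self [FiniteDimensional ℚ K] (hK2 : Module.finrank ℚ K = 2)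
    (hsp : sp ^ 2 = -(p : K)) {g : ℚ} (hg : 0 < g) : clsQ K g * clsQ K g = 1 := by
  rw [← clsQ_mul hg hg, clsQ_eq_one_iff hK2 hsp (mul_pos hg hg)]
  exact .of_isSquare ⟨g, rfl⟩

lemma isNormForm_mul_of_clsQ_eq [FiniteDimensional ℚ K] (hK2 : Module.finrank ℚ K = 2)
    (hsp : sp ^ 2 = -(p : K)) {g h : ℚ} (hg : 0 < g) (hh : 0 < h) (hgh : clsQ K g = clsQ K h) :
    IsNormForm (p : ℚ) (g * h) := by
  rw [← clsQ_eq_one_iff hK2 hsp (mul_pos hg hh), clsQ_mul hg hh, hgh, clsQ_mul_self hK2 hsp hh]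

lemma isNormForm_padic_of_clsQ_eq [FiniteDimensional ℚ K] (hK2 : Module.finrank ℚ K = 2)
    (hsp : sp ^ 2 = -(p : K)) {g h : ℚ} (hg : 0 < g) (hh : 0 < h) (hgh : clsQ K g = clsQ K h)
    {l : ℕ} [Fact l.Prime] (H : IsNormForm (p : ℚ_[l]) (g : ℚ_[l])) :
    IsNormForm (p : ℚ_[l]) (h : ℚ_[l]) :=
  H.of_mul_left (by exact_mod_cast hg.ne') (by
    exact_mod_cast (isNormForm_mul_of_clsQ_eq hK2 hsp hg hh hgh).ratCast (F := ℚ_[l]))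

lemma isNormForm_padic_of_clsQ_mem_gammaRs [FiniteDimensional ℚ K] (hp1 : p % 4 = 1)
    (hK2 : Module.finrank ℚ K = 2) (hsp : sp ^ 2 = -(p : K)) {σ : K →ₐ[ℚ] K} (hσ : σ sp = -sp)
    {g : ℚ} (hg : 0 < g) (h : clsQ K g ∈ GammaRs K) {l : ℕ} [hl : Fact l.Prime] (hl2 : l ≠ 2)
    (hlp : l ≠ p) : IsNormForm (p : ℚ_[l]) (g : ℚ_[l]) := by
  suffices H : ∀ x ∈ GammaRs K, ∃ g : ℚ, 0 < g ∧ clsQ K g = x ∧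
      IsNormForm (p : ℚ_[l]) (g : ℚ_[l]) by
    obtain ⟨g', hg', hgg', H'⟩ := H _ h
    exact isNormForm_padic_of_clsQ_eq hK2 hsp hg' hg hgg' H'
  intro x hx
  induction hx using Subgroup.closure_induction with
  | mem x hx =>
    obtain ⟨q, hq, hqs, rfl⟩ := hx
    refine ⟨q, by exact_mod_cast hq.pos, rfl, ?_⟩
    rw [isSplit_or_isRamified_iff hp1 hK2 hsp hσ hq] at hqs
    by_cases hql : q = l
    · subst hql
      exact Padic.isNormForm_of_isSquare_neg_zmod hl2 hlp hqs _
    · have := Padic.isNormForm_of_unit hl2 (d := p) (a := q)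
        (by rw [Int.cast_natCast, Ne, ZMod.natCast_eq_zero_iff,
          Nat.prime_dvd_prime_iff_eq hl.out hp.out]; exact hlp)
        (by rw [Int.cast_natCast, Ne, ZMod.natCast_eq_zero_iff,
          Nat.prime_dvd_prime_iff_eq hl.out hq]; exact Ne.symm hql)
      exact_mod_cast this
  | one =>
    exact ⟨1, one_pos, (clsQ_eq_one_iff hK2 hsp one_pos).2 (.of_isSquare ⟨1, by simp⟩),
      .of_isSquare ⟨1, by simp⟩⟩
  | mul x y _ _ hx hy =>
    obtain ⟨a, ha, rfl, ha'⟩ := hx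
    obtain ⟨b, hb, rfl, hb'⟩ := hy
    exact ⟨a * b, mul_pos ha hb, clsQ_mul ha hb, by push_cast; exact ha'.mul hb'⟩
  | inv x _ hx =>
    obtain ⟨a, ha, rfl, ha'⟩ := hx
    exact ⟨a, ha, eq_inv_of_mul_eq_one_left (clsQ_mul_self hK2 hsp ha), ha'⟩

lemma clsQ_mem_gammaRs_of_forall_padic [FiniteDimensional ℚ K] (hp1 : p % 4 = 1)
    (hK2 : Module.finrank ℚ K = 2) (hsp : sp ^ 2 = -(p : K)) {σ : K →ₐ[ℚ] K} (hσ : σ sp = -sp)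
    {g : ℚ} (hg : 0 < g) (h : ∀ (l : ℕ) [Fact l.Prime], l ≠ 2 → l ≠ p →
      IsNormForm (p : ℚ_[l]) (g : ℚ_[l])) : clsQ K g ∈ GammaRs K := by
  obtain ⟨n, hn, c, hc, rfl⟩ := exists_squarefree_eq_mul_sq hg
  have hn0 : 0 < n := Nat.pos_of_ne_zero hn.ne_zero
  have hc2 : clsQ K (c ^ 2) = 1 :=
    (clsQ_eq_one_iff hK2 hsp (by positivity)).2 (.of_isSquare ⟨c, sq c⟩)
  rw [clsQ_mul (by exact_mod_cast hn0) (by positivity), hc2, mul_one]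
  have hprime : ∀ q : ℕ, q.Prime → q ∣ n → clsQ K (q : ℚ) ∈ GammaRs K := by
    intro q hq hqn
    refine Subgroup.subset_closure ⟨q, hq, ?_, rfl⟩
    rw [isSplit_or_isRamified_iff hp1 hK2 hsp hσ hq]
    by_cases hq2 : q = 2
    · subst hq2
      generalize -(p : ZMod 2) = x
      revert x
      decide
    by_cases hqp : q = p
    · subst hqp
      simp
    have : Fact q.Prime := ⟨hq⟩
    have h1 := h q hq2 hqp
    push_cast at h1
    rw [IsNormForm.mul_sq_iff (by exact_mod_cast hc)] at h1
    have h2 := IsTernaryIsotropic.isSquare_zmod (q := q) (a := -p) (b := n)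
      (Padic.valuation_intCast_eq_one (Int.squarefree_natCast.2 hn) (by exact_mod_cast hqn))
      (by simpa using h1.isTernaryIsotropic)
    simpa using h2
  clear h hn hg
  induction n using induction_on_primes with
  | zero => exact absurd hn0 (lt_irrefl 0)
  | one =>
    rw [Nat.cast_one, (clsQ_eq_one_iff hK2 hsp one_pos).2 (.of_isSquare ⟨1, by simp⟩)]
    exact one_mem _
  | prime_mul q m hq ih =>
    have hm : 0 < m := Nat.pos_of_mul_pos_left hn0
    rw [Nat.cast_mul, clsQ_mul (by exact_mod_cast hq.pos) (by exact_mod_cast hm)]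
    exact mul_mem (hprime q hq (dvd_mul_right q m))
      (ih hm fun r hr hrm => hprime r hr (hrm.mul_left q))

/-- The product of two nontrivial classes of `Γ_rs` is trivial. -/
lemma clsQ_mul_eq_one_of_mem_gammaRs [FiniteDimensional ℚ K] (hp1 : p % 4 = 1)
    (hK2 : Module.finrank ℚ K = 2) (hsp : sp ^ 2 = -(p : K)) {σ : K →ₐ[ℚ] K} (hσ : σ sp = -sp)
    {g h : ℚ} (hg : 0 < g) (hh : 0 < h) (hgm : clsQ K g ∈ GammaRs K) (hhm : clsQ K h ∈ GammaRs K)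
    (hg1 : clsQ K g ≠ 1) (hh1 : clsQ K h ≠ 1) : clsQ K g * clsQ K h = 1 := by
  have hp2 : p ≠ 2 := by omega
  have key : ∀ {a : ℚ}, 0 < a → clsQ K a ∈ GammaRs K → IsNormForm (p : ℚ_[p]) (a : ℚ_[p]) →
      clsQ K a = 1 := by
    intro a ha ham hap
    refine (clsQ_eq_one_iff hK2 hsp ha).2 (isNormForm_of_forall_padic ha fun l _ hl2 => ?_)
    by_cases hlp : l = p
    · subst hlp
      convert hap
    · exact isNormForm_padic_of_clsQ_mem_gammaRs hp1 hK2 hsp hσ ha ham hl2 hlp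
  rw [← clsQ_mul hg hh]
  refine key (mul_pos hg hh) (by rw [clsQ_mul hg hh]; exact mul_mem hgm hhm) ?_
  exact Padic.isNormForm_self_mul_of_not hp2 hg hh (fun H => hg1 (key hg hgm H))
    fun H => hh1 (key hh hhm H)

end Quadratic

theorem stmt6
    (p : ℕ) [hp : Fact p.Prime] (hp1 : p % 4 = 1)
    (K : Type) [Field K] [Algebra ℚ K] [FiniteDimensional ℚ K]
    (hK2 : Module.finrank ℚ K = 2)
    (sp : K) (hsp : sp ^ 2 = -(p : K))
    (σ : K →ₐ[ℚ] K) (hσ : σ sp = -sp) :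
    -- Γ_rs is cyclic of order 2,
    Nat.card (GammaRs K) = 2 ∧ IsCyclic (GammaRs K) ∧
    -- and a positive rational g represents its nontrivial element iff g is not a local
    -- norm at 2 nor at p, but is a local norm at every other prime ℓ.
    (∀ g : ℚ, 0 < g →
      ((clsQ K g ∈ GammaRs K ∧ clsQ K g ≠ 1) ↔
        (¬ IsLocalNorm K σ 2 g ∧ ¬ IsLocalNorm K σ p g ∧
          ∀ (ℓ : ℕ) [Fact ℓ.Prime], ℓ ≠ 2 → ℓ ≠ p → IsLocalNorm K σ ℓ g))) := by
  obtain ⟨l, hl, hl4, hls⟩ := exists_prime_mod_four_eq_three_isSquare_neg hp1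
  have hl0 : (0 : ℚ) < l := by exact_mod_cast hl.pos
  have hlm : clsQ K (l : ℚ) ∈ GammaRs K := Subgroup.subset_closure
    ⟨l, hl, (isSplit_or_isRamified_iff hp1 hK2 hsp hσ hl).2 hls, rfl⟩
  have hl2 : ¬ IsNormForm (p : ℚ_[2]) ((l : ℚ) : ℚ_[2]) := by
    have := not_isNormForm_two_adic (d := p) (n := l) (by omega) (by omega)
    exact_mod_cast this
  have hl1 : clsQ K (l : ℚ) ≠ 1 := fun H =>
    hl2 ((clsQ_eq_one_iff hK2 hsp hl0).1 H).ratCast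
  have hlp : ∀ g : ℚ, 0 < g → clsQ K g ∈ GammaRs K → clsQ K g ≠ 1 → clsQ K g = clsQ K (l : ℚ) :=
    fun g hg hgm hg1 => mul_right_cancel
      ((clsQ_mul_eq_one_of_mem_gammaRs hp1 hK2 hsp hσ hg hl0 hgm hlm hg1 hl1).trans
        (clsQ_mul_self hK2 hsp hl0).symm)
  have hcard : Nat.card (GammaRs K) = 2 := by
    rw [Nat.card_eq_two_iff' (1 : GammaRs K)]
    refine ⟨⟨_, hlm⟩, fun H => hl1 (congrArg Subtype.val H), ?_⟩
    rintro ⟨x, hx⟩ hx1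
    obtain ⟨g, hg, rfl⟩ := exists_clsQ_eq x
    exact Subtype.ext (hlp g hg hx fun H => hx1 (Subtype.ext H))
  refine ⟨hcard, isCyclic_of_prime_card hcard, fun g hg => ?_⟩
  simp only [isLocalNorm_iff hK2 hsp hσ _ hg.ne']
  constructor
  · rintro ⟨hgm, hg1⟩
    have haway : ∀ (ℓ : ℕ) [Fact ℓ.Prime], ℓ ≠ 2 → ℓ ≠ p → IsNormForm (p : ℚ_[ℓ]) (g : ℚ_[ℓ]) :=
      fun ℓ _ h2 hp => isNormForm_padic_of_clsQ_mem_gammaRs hp1 hK2 hsp hσ hg hgm h2 hp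
    refine ⟨fun H => hl2 (isNormForm_padic_of_clsQ_eq hK2 hsp hg hl0 (hlp g hg hgm hg1) H),
      fun H => hg1 ?_, haway⟩
    refine (clsQ_eq_one_iff hK2 hsp hg).2 (isNormForm_of_forall_padic hg fun ℓ _ h2 => ?_)
    by_cases h : ℓ = p
    · subst h
      convert H
    · exact haway ℓ h2 h
  · rintro ⟨h2, -, h⟩
    exact ⟨clsQ_mem_gammaRs_of_forall_padic hp1 hK2 hsp hσ hg h,
      fun H => h2 ((clsQ_eq_one_iff hK2 hsp hg).1 H).ratCast⟩
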